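/- Let H be an anisotropic Hermitian space over a *-sfield F containing a unit vector. Then H is transitive (i.e., for any nonzero u, v ∈ H there is a unitary operator U with U(u) ∈ span{v}) if and only if H admits unit vectors (every one-dimensional subspace contains a vector of length 1). -/

import Mathlib

/-- An (anisotropic) Hermitian space over a ⋆-sfield `F`. -/
structure HermSpace (F : Type*) [DivisionRing F] [StarRing F]
    (H : Type*) [AddCommGroup H] [Module F H] where
  form : H → H → F
  add_left : ∀ u v w : H, form (u + v) w = form u w + form v w
  smul_left : ∀ (a : F) (u w : H), form (a • u) w = a * form u w
  conj_symm : ∀ u v : H, form u v = star (form v u)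
  anisotropic : ∀ u : H, form u u = 0 → u = 0

/-- A unitary operator: a linear bijection preserving the Hermitian form. -/
def IsUnitaryOp {F : Type*} [DivisionRing F] [StarRing F]
    {H : Type*} [AddCommGroup H] [Module F H] (hs : HermSpace F H)
    (U : H →ₗ[F] H) : Prop :=
  Function.Bijective U ∧ ∀ u v : H, hs.form (U u) (U v) = hs.form u v

namespace HermSpace

variable {F : Type*} [DivisionRing F] [StarRing F]
  {H : Type*} [AddCommGroup H] [Module F H] (hs : HermSpace F H)

theorem add_right (u v w : H) : hs.form u (v + w) = hs.form u v + hs.form u w := by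
  rw [hs.conj_symm u, hs.add_left, star_add, ← hs.conj_symm, ← hs.conj_symm]

theorem smul_right (a : F) (u w : H) : hs.form u (a • w) = hs.form u w * star a := by
  rw [hs.conj_symm u, hs.smul_left, star_mul, ← hs.conj_symm]

theorem sub_left (u v w : H) : hs.form (u - v) w = hs.form u w - hs.form v w := by
  have h := hs.add_left (u - v) v w
  rw [sub_add_cancel] at h
  rw [h, add_sub_cancel_right]

theorem sub_right (u v w : H) : hs.form u (v - w) = hs.form u v - hs.form u w := by
  have h := hs.add_right u (v - w) w
  rw [sub_add_cancel] at h
  rw [h, add_sub_cancel_right]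

/-- The quasi-reflection along `d` with parameter `c`. -/
def refl (d : H) (c : F) : H →ₗ[F] H where
  toFun x := x - (hs.form x d * c) • d
  map_add' x y := by rw [hs.add_left, add_mul, add_smul]; abel
  map_smul' a x := by
    simp only [hs.smul_left, RingHom.id_apply, smul_sub, smul_smul, mul_assoc]

theorem refl_apply (d : H) (c : F) (x : H) :
    hs.refl d c x = x - (hs.form x d * c) • d := rfl

theorem exists_unitary (u v : H) (hu : hs.form u u = 1) (hv : hs.form v v = 1) :
    ∃ U : H →ₗ[F] H, IsUnitaryOp hs U ∧ U u = v := by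
  by_cases huv : u = v
  · exact ⟨LinearMap.id, ⟨Function.bijective_id, fun _ _ => rfl⟩, huv⟩
  obtain ⟨d, hd⟩ : ∃ d, d = u - v := ⟨_, rfl⟩
  obtain ⟨a, ha⟩ : ∃ a, a = hs.form u d := ⟨_, rfl⟩
  have hdd : hs.form d d = a + star a := by
    have h1 : star (hs.form u v) = hs.form v u := (hs.conj_symm v u).symm
    rw [ha, hd]
    simp only [hs.sub_left, hs.sub_right, hu, hv, star_sub, star_one, h1]
    abel
  have ha0 : a ≠ 0 := by
    intro h
    rw [h, star_zero, add_zero] at hdd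
    have h2 := hs.anisotropic d hdd
    rw [hd] at h2
    exact huv (sub_eq_zero.mp h2)
  obtain ⟨c, hc⟩ : ∃ c, c = a⁻¹ := ⟨_, rfl⟩
  have hac : a * c = 1 := by rw [hc, mul_inv_cancel₀ ha0]
  have hca : c * a = 1 := by rw [hc, inv_mul_cancel₀ ha0]
  have hac' : star c * star a = 1 := by rw [← star_mul, hac, star_one]
  have hca' : star a * star c = 1 := by rw [← star_mul, hca, star_one]
  have k1 : c * (a + star a) * star c = c + star c := by
    rw [mul_add, add_mul, hca, one_mul, mul_assoc, hca', mul_one, add_comm]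
  have k2 : star c * (a + star a) * c = c + star c := by
    rw [mul_add, add_mul, hac', one_mul, mul_assoc, hac, mul_one, add_comm]
  have hpres : ∀ x y, hs.form (hs.refl d c x) (hs.refl d c y) = hs.form x y := by
    intro x y
    have h1 : star (hs.form y d) = hs.form d y := (hs.conj_symm d y).symm
    have h2 : hs.form x d * (c * (a + star a) * star c) * hs.form d y
      = hs.form x d * (c + star c) * hs.form d y := by rw [k1]
    simp only [refl_apply, hs.sub_left, hs.sub_right, hs.smul_left, hs.smul_right, hdd,
      star_mul, h1]
    rw [← sub_eq_zero, ← sub_eq_zero.mpr h2]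
    noncomm_ring
  refine ⟨hs.refl d c, ⟨⟨?_, ?_⟩, hpres⟩, ?_⟩
  · rw [injective_iff_map_eq_zero]
    intro x hx
    apply hs.anisotropic
    rw [← hpres, hx]
    have := hs.smul_left 0 0 0
    rwa [zero_smul, zero_mul] at this
  · intro x
    refine ⟨hs.refl d (star c) x, ?_⟩
    have h2 : hs.form x d * (star c * (a + star a) * c)
      = hs.form x d * (c + star c) := by rw [k2]
    simp only [refl_apply, hs.sub_left, hs.smul_left, hdd]
    rw [sub_sub, ← add_smul]
    have : hs.form x d * star c + (hs.form x d - hs.form x d * star c * (a + star a)) * c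
        = 0 := by
      have h3 := sub_eq_zero.mpr h2.symm
      rw [← h3]
      noncomm_ring
    rw [this, zero_smul, sub_zero]
  · rw [refl_apply, ← ha, hac, one_smul, hd, sub_sub_cancel]

end HermSpace

/-- A Hermitian space containing a unit vector is transitive iff it admits unit vectors. -/
theorem stmt7 {F : Type*} [DivisionRing F] [StarRing F]
    {H : Type*} [AddCommGroup H] [Module F H] (hs : HermSpace F H)
    (hz : ∃ z : H, hs.form z z = 1) :
    (∀ u v : H, u ≠ 0 → v ≠ 0 →
        ∃ U : H →ₗ[F] H, IsUnitaryOp hs U ∧ U u ∈ Submodule.span F ({v} : Set H)) ↔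
    (∀ u : H, u ≠ 0 →
        ∃ w ∈ Submodule.span F ({u} : Set H), hs.form w w = 1) := by
  constructor
  · intro h u hu
    obtain ⟨z, hz⟩ := hz
    have hz0 : z ≠ 0 := by
      rintro rfl
      have := hs.smul_left 0 0 0
      rw [zero_smul, zero_mul, hz] at this
      exact one_ne_zero this
    obtain ⟨U, hU, hm⟩ := h z u hz0 hu
    exact ⟨U z, hm, by rw [hU.2, hz]⟩
  · intro h u v hu hv
    obtain ⟨u', hu', hu1⟩ := h u hu
    obtain ⟨v', hv', hv1⟩ := h v hv
    obtain ⟨U, hU, hUv⟩ := hs.exists_unitary u' v' hu1 hv1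
    refine ⟨U, hU, ?_⟩
    obtain ⟨r, rfl⟩ := Submodule.mem_span_singleton.mp hu'
    have hr : r ≠ 0 := by
      rintro rfl
      rw [hs.smul_left, zero_mul] at hu1
      exact zero_ne_one hu1
    have : U u = r⁻¹ • v' := by
      rw [← hUv, map_smul, inv_smul_smul₀ hr]
    rw [this]
    exact Submodule.smul_mem _ _ hv'
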